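/- arXiv:2509.13617 — 2 statements merged into one kernel-verified Lean document; each statement's English description precedes it below -/
import Mathlib

section
/- Let R be an integral domain. Then R is a PvMD if and only if Tor₁^R(X, A), the value at (X, A) of the first left derived functor of the tensor product, is GV-torsion for every R-module X and every torsion-free R-module A. -/
open TensorProduct CategoryTheory

/-- A finitely generated ideal `J` is a GV-ideal if the natural map
`R → Hom_R(J, R)`, sending `r` to multiplication by `r`, is bijective. -/
def IsGVIdeal {R : Type*} [CommRing R] (J : Ideal R) : Prop :=
  J.FG ∧ Function.Bijective fun r : R => (r • J.subtype : J →ₗ[R] R)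

/-- An element `m` of an `R`-module is a GV-torsion element if it is
annihilated by some GV-ideal. -/
def IsGVTorsionElem (R : Type*) [CommRing R] {M : Type*} [AddCommGroup M] [Module R M]
    (m : M) : Prop :=
  ∃ J : Ideal R, IsGVIdeal J ∧ ∀ j ∈ J, j • m = 0

/-- `R` is a PvMD if for every nonzero finitely generated ideal `I` of `R` there is a
GV-ideal `J` with `J ⊆ I·I⁻¹` (inside the quotient field `K`). -/
def IsPvMD (R : Type*) [CommRing R] [IsDomain R] (K : Type*) [Field K] [Algebra R K]
    [IsFractionRing R K] : Prop :=
  ∀ I : Ideal R, I ≠ ⊥ → I.FG →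
    ∃ J : Ideal R, IsGVIdeal J ∧
      (J : FractionalIdeal (nonZeroDivisors R) K) ≤
        (I : FractionalIdeal (nonZeroDivisors R) K) *
          (I : FractionalIdeal (nonZeroDivisors R) K)⁻¹


section Tor

/-- Let `M₂ → M₁ → N → 0` be exact and let `i : N → P` be linear. The homology of
`X ⊗ M₂ → X ⊗ M₁ → X ⊗ P` is the kernel of `X ⊗ N → X ⊗ P`. -/
noncomputable def LinearMap.lTensorHomologyEquivKer {R : Type*} [CommRing R]
    {M₂ M₁ N P : Type*} [AddCommGroup M₂] [AddCommGroup M₁] [AddCommGroup N] [AddCommGroup P]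
    [Module R M₂] [Module R M₁] [Module R N] [Module R P]
    (X : Type*) [AddCommGroup X] [Module R X]
    (f : M₂ →ₗ[R] M₁) (q : M₁ →ₗ[R] N) (i : N →ₗ[R] P)
    (hq : Function.Surjective q) (hfq : Function.Exact f q)
    (h : ∀ z, f.lTensor X z ∈ ker ((i ∘ₗ q).lTensor X)) :
    (ker ((i ∘ₗ q).lTensor X) ⧸ range ((f.lTensor X).codRestrict _ h)) ≃ₗ[R]
      ker (i.lTensor X) :=
  let φ : ker ((i ∘ₗ q).lTensor X) →ₗ[R] ker (i.lTensor X) :=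
    (q.lTensor X).restrict fun z hz => by
      simpa [LinearMap.mem_ker, LinearMap.lTensor_comp] using hz
  have hφ : Function.Surjective φ := fun ⟨t, ht⟩ => by
    obtain ⟨c, rfl⟩ := LinearMap.lTensor_surjective X hq t
    exact ⟨⟨c, by simpa [LinearMap.mem_ker, LinearMap.lTensor_comp] using ht⟩, rfl⟩
  have hker : range ((f.lTensor X).codRestrict _ h) = ker φ := by
    ext ⟨c, hc⟩
    have := lTensor_exact X hfq hq c
    constructor
    · rintro ⟨z, hz⟩
      exact Subtype.ext (this.2 ⟨z, congrArg Subtype.val hz⟩)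
    · intro hz
      obtain ⟨z, hz⟩ := this.1 (congrArg Subtype.val hz)
      exact ⟨z, Subtype.ext hz⟩
  (Submodule.quotEquivOfEq _ _ hker).trans (φ.quotKerEquivOfSurjective hφ)

/-- `Tor₁(X, A)` is the homology of `X ⊗ Q₂ → X ⊗ Q₁ → X ⊗ Q₀` for every projective resolution
`Q` of `A`. -/
noncomputable def torOneEquiv {R : Type u} [CommRing R] {X A : ModuleCat.{u} R}
    (Q : ProjectiveResolution A)
    (h : ∀ z, (Q.complex.d 2 1).hom.lTensor X z ∈
      LinearMap.ker ((Q.complex.d 1 0).hom.lTensor X)) :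
    ((Tor (ModuleCat.{u} R) 1).obj X).obj A ≃ₗ[R]
      (LinearMap.ker ((Q.complex.d 1 0).hom.lTensor X) ⧸
        LinearMap.range (((Q.complex.d 2 1).hom.lTensor X).codRestrict _ h)) :=
  let F := (MonoidalCategory.tensoringLeft (ModuleCat.{u} R)).obj X
  let K := (F.mapHomologicalComplex (ComplexShape.down ℕ)).obj Q.complex
  (Q.isoLeftDerivedObj F 1 ≪≫ K.homologyIsoSc' 2 1 0 (by simp) (by simp) ≪≫
    (K.sc' 2 1 0).moduleCatHomologyIso).toLinearEquiv

/-- For a projective resolution `Q` of `A`, the augmentation `Q₀ → A` is surjective. -/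
theorem exists_projectiveResolution_augmentation {R : Type u} [CommRing R]
    {A : ModuleCat.{u} R} (Q : ProjectiveResolution A) :
    ∃ p : Q.complex.X 0 →ₗ[R] A, Function.Surjective p ∧
      Function.Exact (Q.complex.d 1 0).hom p := by
  let p : Q.complex.X 0 ⟶ A := Q.π.f 0
  have hd : Q.complex.d 1 0 ≫ p = 0 := Q.complex_d_comp_π_f_zero
  refine ⟨p.hom, (ModuleCat.epi_iff_surjective p).1 (inferInstanceAs (Epi (Q.π.f 0))), ?_⟩
  exact (ShortComplex.ShortExact.moduleCat_exact_iff_function_exact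
    (ShortComplex.mk _ _ hd)).1 (ShortComplex.exact_of_g_is_cokernel _ Q.isColimitCokernelCofork)

/-- Every module `A` has a projective module `P` and a surjection `p : P → A` such that
`Tor₁(X, A)` is the kernel of `X ⊗ ker p → X ⊗ P` for all `X`. -/
theorem exists_projective_tor_one_equiv {R : Type u} [CommRing R]
    (A : Type u) [AddCommGroup A] [Module R A] :
    ∃ (P : Type u) (_ : AddCommGroup P) (_ : Module R P) (p : P →ₗ[R] A),
      Module.Projective R P ∧ Function.Surjective p ∧
      ∀ (X : Type u) [AddCommGroup X] [Module R X], Nonempty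
        (((Tor (ModuleCat.{u} R) 1).obj (ModuleCat.of R X)).obj (ModuleCat.of R A) ≃ₗ[R]
          LinearMap.ker ((LinearMap.ker p).subtype.lTensor X)) := by
  obtain ⟨Q⟩ := HasProjectiveResolution.out (Z := ModuleCat.of R A)
  obtain ⟨p, hp, hex⟩ := exists_projectiveResolution_augmentation Q
  have hex' : Function.Exact (Q.complex.d 2 1).hom (Q.complex.d 1 0).hom :=
    (ShortComplex.ShortExact.moduleCat_exact_iff_function_exact
      (ShortComplex.mk _ _ (Q.complex.d_comp_d 2 1 0))).1 (Q.exact_succ 0)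
  refine ⟨Q.complex.X 0, inferInstance, inferInstance, p,
    (IsProjective.iff_projective _).2 (Q.projective 0), hp, fun X _ _ => ?_⟩
  let q : Q.complex.X 1 →ₗ[R] LinearMap.ker p :=
    (Q.complex.d 1 0).hom.codRestrict _ fun z => hex.apply_apply_eq_zero z
  have hq : Function.Surjective q := fun ⟨z, hz⟩ => by
    obtain ⟨y, rfl⟩ := (hex z).1 hz
    exact ⟨y, rfl⟩
  have hq' : Function.Exact (Q.complex.d 2 1).hom q := fun z => by
    rw [← hex' z, ← (LinearMap.ker p).subtype_injective.eq_iff]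
    rfl
  have h (z) : (Q.complex.d 2 1).hom.lTensor X z ∈
      LinearMap.ker ((Q.complex.d 1 0).hom.lTensor X) := by
    rw [LinearMap.mem_ker, ← LinearMap.comp_apply, ← LinearMap.lTensor_comp,
      hex'.linearMap_comp_eq_zero, LinearMap.lTensor_zero, LinearMap.zero_apply]
  exact ⟨(torOneEquiv (X := ModuleCat.of R X) Q h).trans
    (LinearMap.lTensorHomologyEquivKer X (Q.complex.d 2 1).hom q (LinearMap.ker p).subtype
      hq hq' h)⟩

end Tor

section FiniteRank

variable {R : Type*} [CommRing R] {M N P : Type*} [AddCommGroup M] [AddCommGroup N]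
  [AddCommGroup P] [Module R M] [Module R N] [Module R P]

theorem comp_mem_range_dualTensorHom_of_right (g : N →ₗ[R] P) {f : M →ₗ[R] N}
    (hf : f ∈ LinearMap.range (dualTensorHom R M N)) :
    g ∘ₗ f ∈ LinearMap.range (dualTensorHom R M P) := by
  obtain ⟨t, rfl⟩ := hf
  exact ⟨g.lTensor _ t, LinearMap.congr_fun (dualTensorHom_comp_lTensor g) t⟩

theorem comp_mem_range_dualTensorHom_of_left {g : N →ₗ[R] P}
    (hg : g ∈ LinearMap.range (dualTensorHom R N P)) (f : M →ₗ[R] N) :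
    g ∘ₗ f ∈ LinearMap.range (dualTensorHom R M P) := by
  obtain ⟨t, rfl⟩ := hg
  exact ⟨f.dualMap.rTensor _ t, LinearMap.congr_fun (dualTensorHom_comp_rTensor_dualMap f) t⟩

theorem exists_comp_eq_of_mem_range_dualTensorHom {g : N →ₗ[R] P} (hg : Function.Surjective g)
    {f : M →ₗ[R] P} (hf : f ∈ LinearMap.range (dualTensorHom R M P)) :
    ∃ f' ∈ LinearMap.range (dualTensorHom R M N), g ∘ₗ f' = f := by
  obtain ⟨t, rfl⟩ := hf
  obtain ⟨t, rfl⟩ := LinearMap.lTensor_surjective _ hg t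
  exact ⟨_, ⟨t, rfl⟩, (LinearMap.congr_fun (dualTensorHom_comp_lTensor g) t).symm⟩

theorem fg_range_of_mem_range_dualTensorHom {f : M →ₗ[R] N}
    (hf : f ∈ LinearMap.range (dualTensorHom R M N)) :
    ∃ N' : Submodule R N, N'.FG ∧ LinearMap.range f ≤ N' := by
  obtain ⟨t, rfl⟩ := hf
  induction t with
  | zero => exact ⟨⊥, Submodule.fg_bot, by simp⟩
  | tmul φ n =>
    refine ⟨R ∙ n, Submodule.fg_span_singleton n, ?_⟩
    rintro _ ⟨m, rfl⟩
    exact Submodule.smul_mem _ _ (Submodule.mem_span_singleton_self n)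
  | add s t hs ht =>
    obtain ⟨S, hS, hsS⟩ := hs
    obtain ⟨T, hT, htT⟩ := ht
    refine ⟨S ⊔ T, hS.sup hT, ?_⟩
    rintro _ ⟨m, rfl⟩
    rw [map_add]
    exact Submodule.add_mem_sup (hsS ⟨m, rfl⟩) (htT ⟨m, rfl⟩)

theorem Module.Projective.exists_mem_range_dualTensorHom_forall_eq [Module.Projective R M]
    (s : Finset M) :
    ∃ e ∈ LinearMap.range (dualTensorHom R M M), ∀ m ∈ s, e m = m := by
  classical
  obtain ⟨σ, hσ⟩ := Module.projective_def.1 ‹Module.Projective R M›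
  let T : Finset M := s.biUnion fun m => (σ m).support
  refine ⟨∑ i ∈ T, dualTensorHom R M M ((Finsupp.lapply i ∘ₗ σ) ⊗ₜ i),
    Submodule.sum_mem _ fun i _ => ⟨_, rfl⟩, fun m hm => ?_⟩
  have h := hσ m
  rw [Finsupp.linearCombination_apply,
    Finsupp.sum_of_support_subset _ (Finset.subset_biUnion_of_mem (fun m => (σ m).support) hm) _
      (by simp)] at h
  simpa [LinearMap.sum_apply] using h

variable (R M) in
/-- The ideal of scalars `r` such that multiplication by `r` on `M` factors through a finite free
module. -/
noncomputable def finiteRankScalars : Ideal R :=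
  (LinearMap.range (dualTensorHom R M M)).comap (LinearMap.toSpanSingleton R _ LinearMap.id)

theorem mem_finiteRankScalars {r : R} :
    r ∈ finiteRankScalars R M ↔ r • LinearMap.id ∈ LinearMap.range (dualTensorHom R M M) :=
  Iff.rfl

end FiniteRank

section GV

variable {R : Type*} [CommRing R]

theorem isGVIdeal_top : IsGVIdeal (⊤ : Ideal R) := by
  refine ⟨Ideal.fg_top R, fun r s h => ?_, fun φ => ⟨φ ⟨1, trivial⟩, ?_⟩⟩
  · simpa using LinearMap.congr_fun h ⟨1, trivial⟩
  · ext ⟨x, hx⟩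
    have : (⟨x, hx⟩ : (⊤ : Ideal R)) = x • ⟨1, trivial⟩ := Subtype.ext (by simp)
    rw [this, map_smul]
    simp [mul_comm]

theorem IsGVIdeal.eq_of_forall_mul_eq {J : Ideal R} (hJ : IsGVIdeal J) {r s : R}
    (h : ∀ j ∈ J, r * j = s * j) : r = s :=
  hJ.2.1 (LinearMap.ext fun j => by simpa using h j j.2)

theorem IsGVIdeal.mul {I J : Ideal R} (hI : IsGVIdeal I) (hJ : IsGVIdeal J) :
    IsGVIdeal (I * J) := by
  refine ⟨hI.1.mul hJ.1, fun r s h => ?_, fun φ => ?_⟩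
  · refine hI.eq_of_forall_mul_eq fun i hi => hJ.eq_of_forall_mul_eq fun j hj => ?_
    simpa [mul_assoc] using LinearMap.congr_fun h ⟨i * j, Ideal.mul_mem_mul hi hj⟩
  · have hψ (i : I) : ∃ r : R, ∀ j (hj : j ∈ J), r * j = φ ⟨i * j, Ideal.mul_mem_mul i.2 hj⟩ := by
      obtain ⟨r, hr⟩ := hJ.2.2 (φ ∘ₗ (LinearMap.mulLeft R (i : R)).restrict
        fun j hj => Ideal.mul_mem_mul i.2 hj)
      exact ⟨r, fun j hj => LinearMap.congr_fun hr ⟨j, hj⟩⟩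
    choose ψ hψ using hψ
    let Ψ : I →ₗ[R] R :=
      { toFun := ψ
        map_add' := fun x y => hJ.eq_of_forall_mul_eq fun j hj => by
          rw [add_mul, hψ _ j hj, hψ _ j hj, hψ _ j hj, ← map_add]
          exact congrArg φ (Subtype.ext (by simp [add_mul]))
        map_smul' := fun c x => hJ.eq_of_forall_mul_eq fun j hj => by
          rw [RingHom.id_apply, smul_eq_mul, mul_assoc, hψ _ j hj, hψ _ j hj, ← smul_eq_mul c,
            ← map_smul]
          exact congrArg φ (Subtype.ext (by simp [mul_assoc])) }
    obtain ⟨r, hr⟩ := hI.2.2 Ψ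
    refine ⟨r, LinearMap.ext fun ⟨x, hx⟩ => ?_⟩
    have hx' := hx
    refine Submodule.mul_induction_on'
      (C := fun x hx => (r • (I * J).subtype : _ →ₗ[R] R) ⟨x, hx⟩ = φ ⟨x, hx⟩) ?_ ?_ hx
    · intro i hi j hj
      have h1 : r * i = ψ ⟨i, hi⟩ := LinearMap.congr_fun hr ⟨i, hi⟩
      have h2 := hψ ⟨i, hi⟩ j hj
      rw [← h1, mul_assoc] at h2
      exact h2
    · intro x hx y hy h1 h2
      have := congrArg₂ (· + ·) h1 h2
      simp only [← map_add] at this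
      exact this

theorem LinearEquiv.forall_isGVTorsionElem_iff {M N : Type*} [AddCommGroup M] [AddCommGroup N]
    [Module R M] [Module R N] (e : M ≃ₗ[R] N) :
    (∀ m : M, IsGVTorsionElem R m) ↔ ∀ n : N, IsGVTorsionElem R n := by
  rw [e.surjective.forall]
  simp only [IsGVTorsionElem, ← map_smul, e.map_eq_zero_iff]

end GV

section RankOne

variable {R : Type*} [CommRing R] [IsDomain R] {K : Type*} [Field K] [Algebra R K]
  [IsFractionRing R K]

/-- For a nonzero ideal `I` of a domain, multiplication by `r` on `I` factors through a finite
free module if and only if `r ∈ I · I⁻¹`. -/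
theorem mem_finiteRankScalars_ideal_iff {I : Ideal R} (hI : I ≠ ⊥) {r : R} :
    r ∈ finiteRankScalars R I ↔ algebraMap R K r ∈
      (I : FractionalIdeal (nonZeroDivisors R) K) *
        (I : FractionalIdeal (nonZeroDivisors R) K)⁻¹ := by
  have hI' : (I : FractionalIdeal (nonZeroDivisors R) K) ≠ 0 :=
    FractionalIdeal.coeIdeal_ne_zero.2 hI
  have hinj := IsFractionRing.injective R K
  rw [mem_finiteRankScalars]
  constructor
  · rintro ⟨t, ht⟩
    obtain ⟨x₀, hx₀, hx₀'⟩ := Submodule.exists_mem_ne_zero_of_ne_bot hI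
    have hx₀K : algebraMap R K x₀ ≠ 0 := by simpa using hx₀'
    have key (t : Module.Dual R I ⊗[R] I) :
        ∃ k ∈ (I : FractionalIdeal (nonZeroDivisors R) K) *
          (I : FractionalIdeal (nonZeroDivisors R) K)⁻¹,
          ∀ x : I, algebraMap R K (dualTensorHom R I I t x : I) = k * algebraMap R K x := by
      induction t with
      | zero => exact ⟨0, FractionalIdeal.zero_mem _, by simp⟩
      | add s t hs ht =>
        obtain ⟨k, hk, hk'⟩ := hs
        obtain ⟨l, hl, hl'⟩ := ht
        exact ⟨k + l, Submodule.add_mem _ hk hl, fun x => by simp [hk', hl', add_mul]⟩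
      | tmul f y =>
        have hf (x : I) : algebraMap R K (f x) =
            algebraMap R K (f ⟨x₀, hx₀⟩) / algebraMap R K x₀ * algebraMap R K x := by
          have : x₀ • f x = (x : R) • f ⟨x₀, hx₀⟩ := by
            rw [← map_smul, ← map_smul]
            exact congrArg f (Subtype.ext (mul_comm _ _))
          field_simp
          rw [← map_mul, ← map_mul, mul_comm, mul_comm (f _) (x : R)]
          exact congrArg _ this
        refine ⟨algebraMap R K y * (algebraMap R K (f ⟨x₀, hx₀⟩) / algebraMap R K x₀),
          FractionalIdeal.mul_mem_mul (FractionalIdeal.mem_coeIdeal_of_mem _ y.2) ?_, fun x => ?_⟩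
        · rw [FractionalIdeal.mem_inv_iff hI']
          intro z hz
          obtain ⟨z, hzI, rfl⟩ := (FractionalIdeal.mem_coeIdeal _).1 hz
          rw [← hf ⟨z, hzI⟩]
          exact FractionalIdeal.coe_mem_one _ _
        · rw [mul_assoc, ← hf, ← map_mul, mul_comm]
          rfl
    obtain ⟨k, hk, hk'⟩ := key t
    have h := hk' ⟨x₀, hx₀⟩
    rw [ht] at h
    have : algebraMap R K r * algebraMap R K x₀ = k * algebraMap R K x₀ := by
      rw [← map_mul, ← h]; rfl
    rwa [mul_right_cancel₀ hx₀K this]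
  · intro hr
    have key : ∃ θ ∈ LinearMap.range (dualTensorHom R I I),
        ∀ x : I, algebraMap R K (θ x : I) = algebraMap R K r * algebraMap R K x := by
      refine FractionalIdeal.mul_induction_on
        (C := fun k => ∃ θ ∈ LinearMap.range (dualTensorHom R I I),
          ∀ x : I, algebraMap R K (θ x : I) = k * algebraMap R K x) hr ?_ ?_
      · intro i hi j hj
        obtain ⟨i, hiI, rfl⟩ := (FractionalIdeal.mem_coeIdeal _).1 hi
        rw [FractionalIdeal.mem_inv_iff hI'] at hj
        have hj' (x : I) : ∃ s : R, algebraMap R K s = j * algebraMap R K x :=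
          (FractionalIdeal.mem_one_iff _).1 (hj _ (FractionalIdeal.mem_coeIdeal_of_mem _ x.2))
        choose f hf using hj'
        let F : Module.Dual R I :=
          { toFun := f
            map_add' := fun x y => hinj (by simp [hf, mul_add])
            map_smul' := fun c x => hinj (by simp [hf, mul_left_comm]) }
        refine ⟨_, ⟨F ⊗ₜ ⟨i, hiI⟩, rfl⟩, fun x => ?_⟩
        rw [mul_assoc, ← hf, ← map_mul, mul_comm]
        rfl
      · rintro k l ⟨θ, hθ, hk⟩ ⟨η, hη, hl⟩
        exact ⟨θ + η, Submodule.add_mem _ hθ hη, fun x => by simp [hk, hl, add_mul]⟩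
    obtain ⟨θ, hθ, h⟩ := key
    convert hθ
    ext x
    apply hinj
    rw [h, ← map_mul]
    rfl

/-- A domain is a PvMD if and only if on every finitely generated ideal a GV-ideal of scalars acts
through finite free modules. -/
theorem isPvMD_iff_finiteRankScalars :
    IsPvMD R K ↔ ∀ I : Ideal R, I.FG → ∃ J : Ideal R, IsGVIdeal J ∧ J ≤ finiteRankScalars R I := by
  have key {I J : Ideal R} (hI : I ≠ ⊥) :
      (J : FractionalIdeal (nonZeroDivisors R) K) ≤
        (I : FractionalIdeal (nonZeroDivisors R) K) *
          (I : FractionalIdeal (nonZeroDivisors R) K)⁻¹ ↔ J ≤ finiteRankScalars R I := by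
    constructor
    · exact fun h r hr =>
        (mem_finiteRankScalars_ideal_iff hI).2 (h (FractionalIdeal.mem_coeIdeal_of_mem _ hr))
    · intro h k hk
      obtain ⟨r, hr, rfl⟩ := (FractionalIdeal.mem_coeIdeal _).1 hk
      exact (mem_finiteRankScalars_ideal_iff hI).1 (h hr)
  constructor
  · intro h I hI
    by_cases hI0 : I = ⊥
    · subst hI0
      refine ⟨⊤, isGVIdeal_top, fun r _ => ?_⟩
      rw [mem_finiteRankScalars, Subsingleton.elim (r • LinearMap.id) 0]
      exact Submodule.zero_mem _
    · obtain ⟨J, hJ, hJI⟩ := h I hI0 hI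
      exact ⟨J, hJ, (key hI0).1 hJI⟩
  · intro h I hI0 hI
    obtain ⟨J, hJ, hJI⟩ := h I hI
    exact ⟨J, hJ, (key hI0).2 hJI⟩

end RankOne

section Forward

variable {R : Type*} [CommRing R]

/-- A finitely generated torsion-free module over a domain embeds into a finite free module. -/
theorem exists_injective_fin_fun [IsDomain R] (A : Type*) [AddCommGroup A] [Module R A]
    [Module.Finite R A]
    (hA : ∀ (r : R) (a : A), r • a = 0 → r = 0 ∨ a = 0) :
    ∃ (n : ℕ) (φ : A →ₗ[R] (Fin n → R)), Function.Injective φ := by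
  let K := FractionRing R
  let V := LocalizedModule (nonZeroDivisors R) A
  let ι : A →ₗ[R] V := LocalizedModule.mkLinearMap (nonZeroDivisors R) A
  have hι (a : A) (ha : ι a = 0) : a = 0 := by
    obtain ⟨c, hc⟩ := (IsLocalizedModule.eq_zero_iff (nonZeroDivisors R) ι).1 ha
    exact (hA c a hc).resolve_left (nonZeroDivisors.coe_ne_zero c)
  have : Module.Finite K V := Module.Finite.of_isLocalizedModule (nonZeroDivisors R) ι
  let b := Module.finBasis K V
  obtain ⟨s, hs⟩ := Module.Finite.fg_top (R := R) (M := A)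
  obtain ⟨d, hd⟩ := IsLocalization.exist_integer_multiples_of_finite (nonZeroDivisors R)
    (fun x : s × Fin (Module.finrank K V) => b.repr (ι x.1) x.2)
  let coord (i) : A →ₗ[R] K := (d : R) • ((b.coord i).restrictScalars R ∘ₗ ι)
  have hcoord (i) (a : A) : coord i a ∈ LinearMap.range (Algebra.linearMap R K) := by
    have : (⊤ : Submodule R A) ≤ (LinearMap.range (Algebra.linearMap R K)).comap (coord i) := by
      rw [← hs, Submodule.span_le]
      exact fun a ha => hd (⟨a, ha⟩, i)
    exact this trivial
  let e := LinearEquiv.ofInjective (Algebra.linearMap R K) (IsFractionRing.injective R K)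
  refine ⟨_, LinearMap.pi fun i => e.symm.toLinearMap ∘ₗ (coord i).codRestrict _ (hcoord i),
    (injective_iff_map_eq_zero _).2 fun a ha => hι a ?_⟩
  refine b.ext_elem fun i => ?_
  have h1 : (coord i).codRestrict _ (hcoord i) a = 0 :=
    (map_eq_zero_iff _ e.symm.injective).1 (congrFun ha i)
  have h2 : (d : R) • b.repr (ι a) i = 0 := congrArg Subtype.val h1
  rw [Algebra.smul_def, mul_eq_zero] at h2
  simpa using h2

/-- If for every finitely generated ideal a GV-ideal of scalars acts through finite free modules,
then the same holds for every finitely generated submodule of a finite free module. -/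
theorem exists_isGVIdeal_le_finiteRankScalars_of_injective
    (h : ∀ I : Ideal R, I.FG → ∃ J : Ideal R, IsGVIdeal J ∧ J ≤ finiteRankScalars R I)
    (n : ℕ) {A : Type*} [AddCommGroup A] [Module R A] [Module.Finite R A]
    (φ : A →ₗ[R] (Fin n → R)) (hφ : Function.Injective φ) :
    ∃ J : Ideal R, IsGVIdeal J ∧ J ≤ finiteRankScalars R A := by
  induction n generalizing A with
  | zero =>
    have : Subsingleton A := hφ.subsingleton
    refine ⟨⊤, isGVIdeal_top, fun r _ => ?_⟩
    rw [mem_finiteRankScalars, Subsingleton.elim (r • LinearMap.id) 0]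
    exact Submodule.zero_mem _
  | succ n ih =>
    let p : A →ₗ[R] R := LinearMap.proj 0 ∘ₗ φ
    obtain ⟨J, hJ, hJI⟩ := h (LinearMap.range p) (Module.Finite.iff_fg.1 inferInstance)
    have hθ (a : J) : ∃ θ ∈ LinearMap.range (dualTensorHom R A A), ∀ x, p (θ x) = a * p x := by
      obtain ⟨θ, hθ, h⟩ := exists_comp_eq_of_mem_range_dualTensorHom p.surjective_rangeRestrict
        (comp_mem_range_dualTensorHom_of_left (hJI a.2) p.rangeRestrict)
      exact ⟨θ, hθ, fun x => congrArg Subtype.val (LinearMap.congr_fun h x)⟩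
    choose θ hθ hpθ using hθ
    let δ (a : J) : A →ₗ[R] A := (a : R) • LinearMap.id - θ a
    obtain ⟨s, hs⟩ := Module.Finite.iff_fg.2 hJ.1
    let B : Submodule R A := ⨆ a ∈ s, LinearMap.range (δ a)
    have hB : B.FG := Submodule.fg_biSup s _ fun a _ => Module.Finite.iff_fg.1 inferInstance
    have : Module.Finite R B := Module.Finite.iff_fg.2 hB
    have hBp : B ≤ LinearMap.ker p := by
      refine iSup₂_le fun a _ => ?_
      rintro _ ⟨x, rfl⟩
      simp [δ, hpθ]
    obtain ⟨J', hJ', hJB⟩ := ih (LinearMap.funLeft R R Fin.succ ∘ₗ φ ∘ₗ B.subtype)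
      ((injective_iff_map_eq_zero _).2 fun b hb => by
        refine Subtype.ext ((map_eq_zero_iff φ hφ).1 (funext fun i => ?_))
        cases i using Fin.cases with
        | zero => exact hBp b.2
        | succ i => exact congrFun hb i)
    refine ⟨J * J', hJ.mul hJ', Ideal.mul_le.2 fun a ha b hb => ?_⟩
    have key : (⊤ : Submodule R J) ≤
        Submodule.comap (LinearMap.mulRight R b ∘ₗ J.subtype) (finiteRankScalars R A) := by
      rw [← hs, Submodule.span_le]
      intro a ha
      have hδ (x) : δ a x ∈ B := le_iSup₂ (f := fun a (_ : a ∈ s) => LinearMap.range (δ a)) a ha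
        ⟨x, rfl⟩
      have : ((a : R) * b) • LinearMap.id =
          b • θ a + B.subtype ∘ₗ (b • LinearMap.id) ∘ₗ (δ a).codRestrict B hδ := by
        ext x
        simp [δ, smul_sub, mul_smul, smul_comm b]
      change ((a : R) * b) • LinearMap.id ∈ LinearMap.range (dualTensorHom R A A)
      rw [this]
      exact Submodule.add_mem _ (Submodule.smul_mem _ _ (hθ a))
        (comp_mem_range_dualTensorHom_of_right _
          (comp_mem_range_dualTensorHom_of_left (hJB hb) _))
    exact key (x := ⟨a, ha⟩) trivial

/-- Under the same hypothesis, the kernel of `X ⊗ ker p → X ⊗ P` is GV-torsion for every surjection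
`p` from a projective module `P` onto a torsion-free module. -/
theorem isGVTorsionElem_of_lTensor_subtype_ker_eq_zero [IsDomain R]
    (h : ∀ I : Ideal R, I.FG → ∃ J : Ideal R, IsGVIdeal J ∧ J ≤ finiteRankScalars R I)
    {A P X : Type*} [AddCommGroup A] [Module R A] [AddCommGroup P] [Module R P]
    [Module.Projective R P] [AddCommGroup X] [Module R X]
    (hA : ∀ (r : R) (a : A), r • a = 0 → r = 0 ∨ a = 0)
    {p : P →ₗ[R] A} (hp : Function.Surjective p) {t : X ⊗[R] LinearMap.ker p}
    (ht : (LinearMap.ker p).subtype.lTensor X t = 0) : IsGVTorsionElem R t := by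
  classical
  obtain ⟨S, hS⟩ := TensorProduct.exists_finset t
  obtain ⟨e, he, heS⟩ := Module.Projective.exists_mem_range_dualTensorHom_forall_eq (R := R)
    (S.image fun i => (i.2 : P))
  obtain ⟨A₀, hA₀, hpe⟩ := fg_range_of_mem_range_dualTensorHom
    (comp_mem_range_dualTensorHom_of_right p he)
  have : Module.Finite R A₀ := Module.Finite.iff_fg.2 hA₀
  obtain ⟨n, φ, hφ⟩ := exists_injective_fin_fun A₀ fun r a hra =>
    (hA r a (congrArg Subtype.val hra)).imp_right Subtype.ext
  obtain ⟨J, hJ, hJA⟩ := exists_isGVIdeal_le_finiteRankScalars_of_injective h n φ hφ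
  refine ⟨J, hJ, fun r hr => ?_⟩
  obtain ⟨σ, -, hσ⟩ := exists_comp_eq_of_mem_range_dualTensorHom hp
    (comp_mem_range_dualTensorHom_of_right A₀.subtype (hJA hr))
  let u : P →ₗ[R] A₀ := (p ∘ₗ e).codRestrict A₀ fun x => hpe ⟨x, rfl⟩
  let g : P →ₗ[R] LinearMap.ker p := (r • e - σ ∘ₗ u).codRestrict _ fun x => by
    have : p (σ (u x)) = r • p (e x) := LinearMap.congr_fun hσ (u x)
    simp [this]
  have hg : g.lTensor X ((LinearMap.ker p).subtype.lTensor X t) = r • t := by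
    rw [hS, map_sum, map_sum, Finset.smul_sum]
    refine Finset.sum_congr rfl fun i hi => ?_
    have hei : e i.2 = i.2 := heS _ (Finset.mem_image_of_mem (fun i => (i.2 : P)) hi)
    have hui : u i.2 = 0 := Subtype.ext (by simp [u, hei])
    have hgi : g i.2 = r • i.2 := Subtype.ext (by simp [g, hei, hui])
    simp [hgi]
  rw [← hg, ht, map_zero]

end Forward

section Backward

/-- A variant of Villamayor's criterion: if the kernel of `X ⊗ N → X ⊗ P` is GV-torsion for all
`X`, then up to a GV-ideal a finite linear system over `N` with a solution in `P` has a solution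
in `N`. -/
theorem exists_isGVIdeal_forall_exists_solution {R : Type u} [CommRing R]
    {P : Type*} [AddCommGroup P] [Module R P] {N : Submodule R P}
    (h : ∀ (X : Type u) [AddCommGroup X] [Module R X] (t : X ⊗[R] N),
      N.subtype.lTensor X t = 0 → IsGVTorsionElem R t)
    {m k : Type} [Fintype m] [Fintype k] (c : m → k → R) (p : k → P) (y : m → N)
    (hy : ∀ i, (y i : P) = ∑ j, c i j • p j) :
    ∃ J : Ideal R, IsGVIdeal J ∧ ∀ r ∈ J, ∃ z : k → N, ∀ i, r • y i = ∑ j, c i j • z j := by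
  classical
  let W : Submodule R (m → R) := Submodule.span R (Set.range fun j i => c i j)
  let X := (m → R) ⧸ W
  let t : X ⊗[R] N := ∑ i, W.mkQ (Pi.single i 1) ⊗ₜ y i
  have ht : N.subtype.lTensor X t = 0 := by
    have hW (j : k) : ∑ i, c i j • W.mkQ (Pi.single i 1) = 0 := by
      simp_rw [← map_smul, ← map_sum]
      rw [← LinearMap.mem_ker, Submodule.ker_mkQ]
      have : ∑ i, c i j • (Pi.single i 1 : m → R) = fun i => c i j := by
        ext i
        simp [Finset.sum_apply, Pi.single_apply]
      rw [this]
      exact Submodule.subset_span (Set.mem_range_self j)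
    simp only [t, map_sum, LinearMap.lTensor_tmul, Submodule.subtype_apply, hy,
      TensorProduct.tmul_sum, TensorProduct.tmul_smul]
    rw [Finset.sum_comm]
    simp only [TensorProduct.smul_tmul', ← TensorProduct.sum_tmul, hW, TensorProduct.zero_tmul,
      Finset.sum_const_zero]
  obtain ⟨J, hJ, hJt⟩ := h X t ht
  refine ⟨J, hJ, fun r hr => ?_⟩
  let Φ : (k → N) →ₗ[R] (m → N) := LinearMap.pi fun i => ∑ j, c i j • LinearMap.proj j
  let β : (m → R) →ₗ[R] N →ₗ[R] (m → N) := LinearMap.mk₂ R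
    (fun (a : m → R) (y : N) i => a i • y)
    (fun _ _ _ => funext fun _ => add_smul _ _ _) (fun _ _ _ => funext fun _ => mul_smul _ _ _)
    (fun _ _ _ => funext fun _ => smul_add _ _ _)
    (fun r a _ => funext fun i => smul_comm (a i) r _)
  let γ : X →ₗ[R] N →ₗ[R] (m → N) ⧸ LinearMap.range Φ :=
    W.liftQ (β.compr₂ (LinearMap.range Φ).mkQ) (by
      rw [Submodule.span_le]
      rintro _ ⟨j, rfl⟩
      refine LinearMap.ext fun y => ?_
      refine (Submodule.Quotient.mk_eq_zero _).2 ⟨Pi.single j y, ?_⟩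
      ext i
      simp [Φ, β, Pi.single_apply])
  have hγ : TensorProduct.lift γ t = (LinearMap.range Φ).mkQ y := by
    have : ∑ i, β (Pi.single i 1) (y i) = y := by
      ext i
      simp [β, Finset.sum_apply, Pi.single_apply]
    rw [← this, map_sum, map_sum]
    rfl
  have h0 : (LinearMap.range Φ).mkQ (r • y) = 0 := by
    rw [map_smul, ← hγ, ← map_smul, hJt r hr, map_zero]
  obtain ⟨z, hz⟩ := (Submodule.Quotient.mk_eq_zero _).1 h0
  refine ⟨z, fun i => ?_⟩
  simpa [Φ] using (congrFun hz i).symm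

/-- If `p` maps a projective module `P` onto a finitely generated ideal `I` and the kernel of
`X ⊗ ker p → X ⊗ P` is GV-torsion for all `X`, then a GV-ideal of scalars acts on `I` through finite
free modules. -/
theorem exists_isGVIdeal_le_finiteRankScalars_of_lTensor {R : Type u} [CommRing R] [IsDomain R]
    {I : Ideal R} (hI : I.FG)
    {P : Type*} [AddCommGroup P] [Module R P] [Module.Projective R P] {p : P →ₗ[R] I}
    (hp : Function.Surjective p)
    (h : ∀ (X : Type u) [AddCommGroup X] [Module R X] (t : X ⊗[R] LinearMap.ker p),
      (LinearMap.ker p).subtype.lTensor X t = 0 → IsGVTorsionElem R t) :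
    ∃ J : Ideal R, IsGVIdeal J ∧ J ≤ finiteRankScalars R I := by
  classical
  obtain ⟨k, x, hx⟩ := Submodule.fg_iff_exists_fin_generating_family.1
    (Module.finite_def.1 (Module.Finite.iff_fg.2 hI))
  by_cases hx0 : ∀ i, x i = 0
  · have : Subsingleton I := by
      refine (Submodule.subsingleton_iff R).1 (subsingleton_of_bot_eq_top ?_)
      rw [← hx, eq_comm, Submodule.span_eq_bot]
      rintro _ ⟨i, rfl⟩
      exact hx0 i
    refine ⟨⊤, isGVIdeal_top, fun r _ => ?_⟩
    rw [mem_finiteRankScalars, Subsingleton.elim (r • LinearMap.id) 0]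
    exact Submodule.zero_mem _
  push Not at hx0
  obtain ⟨o, ho⟩ := hx0
  have ho' : (x o : R) ≠ 0 := by simpa using ho
  choose v hv using fun i => hp (x i)
  let c (i j : Fin k) : R := (if i = j then (x o : R) else 0) - (if o = j then (x i : R) else 0)
  have hc {M : Type _} [AddCommGroup M] [Module R M] (w : Fin k → M) (i : Fin k) :
      ∑ j, c i j • w j = (x o : R) • w i - (x i : R) • w o := by
    simp [c, sub_smul, Finset.sum_sub_distrib, ite_smul]
  obtain ⟨J, hJ, hJ'⟩ := exists_isGVIdeal_forall_exists_solution h c v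
    (fun i => ⟨∑ j, c i j • v j, by
      rw [hc, LinearMap.mem_ker, map_sub, map_smul, map_smul, hv, hv, sub_eq_zero]
      exact Subtype.ext (mul_comm _ _)⟩) (fun i => rfl)
  refine ⟨J, hJ, fun r hr => ?_⟩
  obtain ⟨z, hz⟩ := hJ' r hr
  let q (i : Fin k) : P := r • v i - z i
  have hpq (i) : p (q i) = r • x i := by simp [q, hv]
  have hq (i) : (x o : R) • q i = (x i : R) • q o := by
    have := congrArg Subtype.val (hz i)
    simp only [Submodule.coe_smul, hc] at this
    simp only [q, smul_sub, smul_comm _ r] at this ⊢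
    rw [sub_eq_sub_iff_sub_eq_sub]
    exact this
  have hcancel {a b : P} (hab : (x o : R) • a = (x o : R) • b) : a = b :=
    smul_right_injective P ho' hab
  have hs (y : I) : ∃ w : P, (x o : R) • w = (y : R) • q o := by
    have hle : (⊤ : Submodule R I) ≤ (LinearMap.range (LinearMap.lsmul R P (x o : R))).comap
        ((LinearMap.toSpanSingleton R P (q o)) ∘ₗ I.subtype) := by
      rw [← hx, Submodule.span_le]
      rintro _ ⟨i, rfl⟩
      exact ⟨q i, hq i⟩
    exact hle (x := y) trivial
  choose s hs using hs
  let σ : I →ₗ[R] P :=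
    { toFun := s
      map_add' := fun a b => hcancel (by simp [hs, add_smul])
      map_smul' := fun a b => hcancel (by simp [hs, mul_smul, smul_comm (x o : R)]) }
  have hpσ (y : I) : p (σ y) = r • y := by
    have : (x o : R) • p (σ y) = (x o : R) • r • y := by
      rw [← map_smul]
      change p ((x o : R) • s y) = _
      rw [hs, map_smul, hpq]
      refine Subtype.ext ?_
      simp only [Submodule.coe_smul, smul_eq_mul]
      ring
    exact smul_right_injective I ho' this
  obtain ⟨e, he, heσ⟩ := Module.Projective.exists_mem_range_dualTensorHom_forall_eq (R := R)
    (Finset.univ.image fun i => σ (x i))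
  have heσ' : e ∘ₗ σ = σ := by
    refine LinearMap.ext_on_range hx fun i => ?_
    exact heσ _ (Finset.mem_image_of_mem _ (Finset.mem_univ i))
  have hr' : r • LinearMap.id = p ∘ₗ e ∘ₗ σ := by
    rw [heσ']
    exact LinearMap.ext fun y => (hpσ y).symm
  rw [mem_finiteRankScalars, hr']
  exact comp_mem_range_dualTensorHom_of_right p (comp_mem_range_dualTensorHom_of_left he σ)

end Backward

/-- `R` is a PvMD iff `Tor₁^R(X, A)` is GV-torsion for every `R`-module
`X` and every torsion-free `R`-module `A`. -/
theorem pvmd_iff_tor_one_torsionFree_gvTorsion {R : Type u} [CommRing R] [IsDomain R] :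
    IsPvMD R (FractionRing R) ↔
      ∀ (X A : Type u) [AddCommGroup X] [Module R X] [AddCommGroup A] [Module R A],
        (∀ (r : R) (a : A), r • a = 0 → r = 0 ∨ a = 0) →
        ∀ x : ((Tor (ModuleCat.{u} R) 1).obj (ModuleCat.of R X)).obj (ModuleCat.of R A),
          IsGVTorsionElem R x := by
  rw [isPvMD_iff_finiteRankScalars]
  constructor
  · intro h X A _ _ _ _ hA
    obtain ⟨P, _, _, p, _, hp, e⟩ := exists_projective_tor_one_equiv (R := R) A
    obtain ⟨e⟩ := e X
    rw [e.forall_isGVTorsionElem_iff]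
    rintro ⟨t, ht⟩
    obtain ⟨J, hJ, hJt⟩ := isGVTorsionElem_of_lTensor_subtype_ker_eq_zero h hA hp ht
    exact ⟨J, hJ, fun j hj => Subtype.ext (hJt j hj)⟩
  · intro h I hI
    obtain ⟨P, _, _, p, _, hp, e⟩ := exists_projective_tor_one_equiv (R := R) I
    refine exists_isGVIdeal_le_finiteRankScalars_of_lTensor hI hp fun X _ _ t ht => ?_
    obtain ⟨e⟩ := e X
    obtain ⟨J, hJ, hJt⟩ := e.forall_isGVTorsionElem_iff.1
      (h X I fun r a hra => smul_eq_zero.1 hra) ⟨t, ht⟩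
    exact ⟨J, hJ, fun j hj => congrArg Subtype.val (hJt j hj)⟩
end

section
/- Let k be a field, R = k[x, y] the polynomial ring in two variables, and I = ⟨x, y⟩ the ideal generated by x and y. Then: (a) I is a GV-ideal of R; (b) the element z := x ⊗ y − y ⊗ x of I ⊗_R I is nonzero and satisfies x·z = 0 and y·z = 0. In particular, I ⊗_R I is not GV-torsion-free, even though R is a PvMD and I is torsion-free. -/
open TensorProduct

theorem Finset.gcd_id_dvd_of_mem_span {R : Type*} [CommRing R] [NormalizedGCDMonoid R]
    {s : Finset R} {r : R} (hr : r ∈ Ideal.span (s : Set R)) : s.gcd id ∣ r := by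
  have hle : Ideal.span (s : Set R) ≤ Ideal.span {s.gcd id} :=
    Ideal.span_le.2 fun b hb => Ideal.mem_span_singleton.2 (Finset.gcd_dvd (f := id) hb)
  exact Ideal.mem_span_singleton.1 (hle hr)

/-- In a unique factorization domain, a finitely generated ideal whose elements have only
units as common divisors is a GV-ideal. -/
theorem IsGVIdeal.of_forall_dvd_isUnit {R : Type*} [CommRing R] [IsDomain R]
    [UniqueFactorizationMonoid R] {J : Ideal R} (hfg : J.FG)
    (h : ∀ d : R, (∀ j ∈ J, d ∣ j) → IsUnit d) : IsGVIdeal J := by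
  classical
  let : StrongNormalizationMonoid R := UniqueFactorizationMonoid.strongNormalizationMonoid
  let : NormalizedGCDMonoid R := UniqueFactorizationMonoid.toNormalizedGCDMonoid R
  have hJ : J ≠ ⊥ := by
    rintro rfl
    exact not_isUnit_zero (h 0 fun j hj => by simp [(Ideal.mem_bot).1 hj])
  obtain ⟨a, haJ, ha⟩ := Submodule.exists_mem_ne_zero_of_ne_bot hJ
  refine ⟨hfg, fun r s hrs => ?_, fun φ => ?_⟩
  · exact mul_right_cancel₀ ha (by simpa using LinearMap.congr_fun hrs ⟨a, haJ⟩)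
  have hφ (b : J) : (b : R) * φ ⟨a, haJ⟩ = a * φ b := by
    rw [← smul_eq_mul, ← smul_eq_mul, ← map_smul, ← map_smul]
    congr 1
    exact Subtype.ext (mul_comm _ _)
  obtain ⟨s, rfl⟩ := hfg
  have hs : IsUnit (s.gcd id) := h _ fun _ => Finset.gcd_id_dvd_of_mem_span
  have hdvd : a ∣ φ ⟨a, haJ⟩ := by
    have : a ∣ s.gcd fun b => id b * φ ⟨a, haJ⟩ := Finset.dvd_gcd fun b hb =>
      ⟨φ ⟨b, Ideal.subset_span hb⟩, hφ ⟨b, Ideal.subset_span hb⟩⟩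
    rw [(Finset.gcd_mul_right' s id _).dvd_iff_dvd_right] at this
    exact hs.dvd_mul_left.1 this
  obtain ⟨r, hr⟩ := hdvd
  refine ⟨r, LinearMap.ext fun b => mul_left_cancel₀ ha ?_⟩
  rw [← hφ b, hr]
  simp only [LinearMap.smul_apply, Submodule.subtype_apply, smul_eq_mul]
  ring

/-- A unique factorization domain is a PvMD. -/
theorem IsPvMD.of_uniqueFactorizationMonoid (R : Type*) [CommRing R] [IsDomain R]
    [UniqueFactorizationMonoid R] (K : Type*) [Field K] [Algebra R K] [IsFractionRing R K] :
    IsPvMD R K := by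
  classical
  let : StrongNormalizationMonoid R := UniqueFactorizationMonoid.strongNormalizationMonoid
  let : NormalizedGCDMonoid R := UniqueFactorizationMonoid.toNormalizedGCDMonoid R
  rintro I hI ⟨s, rfl⟩
  have hne : ∃ b ∈ s, id b ≠ 0 := by
    by_contra! h
    exact hI (Ideal.span_eq_bot.2 h)
  obtain ⟨b₀, hb₀, hb₀0⟩ := hne
  obtain ⟨g, hg, hg1⟩ := s.extract_gcd id ⟨b₀, hb₀⟩
  set d := s.gcd id
  have hd0 : d ≠ 0 := fun h => hb₀0 (Finset.gcd_eq_zero_iff.1 h b₀ hb₀)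
  have hdK : algebraMap R K d ≠ 0 :=
    (map_ne_zero_iff _ (IsFractionRing.injective R K)).2 hd0
  have hI0 : ((Ideal.span (s : Set R) : Ideal R) : FractionalIdeal (nonZeroDivisors R) K) ≠ 0 :=
    FractionalIdeal.coeIdeal_ne_zero.2 hI
  have hinv : (algebraMap R K d)⁻¹ ∈
      ((Ideal.span (s : Set R) : Ideal R) : FractionalIdeal (nonZeroDivisors R) K)⁻¹ := by
    rw [FractionalIdeal.mem_inv_iff hI0]
    intro y hy
    obtain ⟨j, hj, rfl⟩ := (FractionalIdeal.mem_coeIdeal _).1 hy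
    obtain ⟨c, rfl⟩ := Finset.gcd_id_dvd_of_mem_span hj
    rw [map_mul, inv_mul_cancel_left₀ hdK]
    exact (FractionalIdeal.mem_one_iff _).2 ⟨c, rfl⟩
  refine ⟨Ideal.span (s.image g : Finset R), .of_forall_dvd_isUnit ⟨_, rfl⟩ fun e he => ?_, ?_⟩
  · refine isUnit_of_dvd_one (hg1 ▸ Finset.dvd_gcd fun b hb => he _ (Ideal.subset_span ?_))
    exact Finset.mem_coe.2 (Finset.mem_image_of_mem g hb)
  intro x hx
  obtain ⟨j, hj, rfl⟩ := (FractionalIdeal.mem_coeIdeal _).1 hx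
  have hdj : d * j ∈ Ideal.span (s : Set R) := by
    have hle : Ideal.span (s.image g : Finset R) ≤
        Submodule.comap (LinearMap.mulLeft R d) (Ideal.span (s : Set R)) := by
      refine Ideal.span_le.2 fun c hc => ?_
      obtain ⟨b, hb, rfl⟩ := Finset.mem_image.1 (Finset.mem_coe.1 hc)
      simpa [← hg b hb] using Ideal.subset_span (Finset.mem_coe.2 hb)
    exact hle hj
  have := FractionalIdeal.mul_mem_mul (FractionalIdeal.mem_coeIdeal_of_mem (nonZeroDivisors R)
    (P := K) hdj) hinv
  rwa [map_mul, mul_right_comm, mul_inv_cancel₀ hdK, one_mul] at this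

/-- Elements of an ideal `I` kill all commutators `a ⊗ b - b ⊗ a` in `I ⊗ I`. -/
theorem Ideal.smul_tmul_sub_tmul_eq_zero {R : Type*} [CommRing R] {I : Ideal R} (a b : I)
    {c : R} (hc : c ∈ I) : c • (a ⊗ₜ[R] b - b ⊗ₜ[R] a) = 0 := by
  have hswap (u v : I) : (u : R) • v = (v : R) • u := Subtype.ext (mul_comm _ _)
  rw [smul_sub, sub_eq_zero]
  calc c • (a ⊗ₜ[R] b) = a ⊗ₜ ((b : R) • ⟨c, hc⟩) := by
        rw [← TensorProduct.tmul_smul, ← hswap ⟨c, hc⟩]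
    _ = b ⊗ₜ ((a : R) • ⟨c, hc⟩) := by
        rw [← TensorProduct.smul_tmul, hswap b a, TensorProduct.smul_tmul]
    _ = c • (b ⊗ₜ[R] a) := by
        rw [← TensorProduct.tmul_smul, ← hswap ⟨c, hc⟩]

/-- A derivation of `A` induces an `A`-linear map from an ideal `I` to `A ⧸ I`. -/
def Derivation.idealToQuotient {k A : Type*} [CommRing k] [CommRing A] [Algebra k A]
    (D : Derivation k A A) (I : Ideal A) : I →ₗ[A] A ⧸ I where
  toFun f := Ideal.Quotient.mk I (D f)
  map_add' f g := by simp
  map_smul' r f := by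
    have : Ideal.Quotient.mk I (f : A) = 0 := Ideal.Quotient.eq_zero_iff_mem.2 f.2
    simp [Algebra.smul_def, this]

/-- If derivations `D`, `E` are dual to `a, b ∈ I` modulo the proper ideal `I`, then
`a ⊗ b ≠ b ⊗ a` in `I ⊗ I`. -/
theorem Ideal.tmul_sub_tmul_ne_zero {k A : Type*} [CommRing k] [CommRing A] [Algebra k A]
    {I : Ideal A} (hI : I ≠ ⊤) (D E : Derivation k A A) (a b : I)
    (hDa : D a = 1) (hDb : D b = 0) (hEb : E b = 1) :
    a ⊗ₜ[A] b - b ⊗ₜ[A] a ≠ 0 := by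
  intro h
  have := congrArg (LinearMap.mul' A (A ⧸ I) ∘ₗ
    TensorProduct.map (D.idealToQuotient I) (E.idealToQuotient I)) h
  have hone : (1 : A ⧸ I) = 0 := by
    simpa [Derivation.idealToQuotient, hDa, hDb, hEb] using this
  exact hI ((Ideal.eq_top_iff_one I).2 (Ideal.Quotient.eq_zero_iff_mem.1 (by simpa using hone)))

theorem MvPolynomial.span_X_pair_ne_top (k : Type*) [Field k] :
    (Ideal.span {X 0, X 1} : Ideal (MvPolynomial (Fin 2) k)) ≠ ⊤ := by
  intro h
  have hle : (Ideal.span {X 0, X 1} : Ideal (MvPolynomial (Fin 2) k)) ≤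
      RingHom.ker (constantCoeff : MvPolynomial (Fin 2) k →+* k) :=
    Ideal.span_le.2 (by rintro f (rfl | rfl) <;> simp [RingHom.mem_ker])
  have h1 := hle (h ▸ Submodule.mem_top (x := (1 : MvPolynomial (Fin 2) k)))
  simp [RingHom.mem_ker] at h1

theorem MvPolynomial.isGVIdeal_span_X_pair (k : Type*) [Field k] :
    IsGVIdeal (Ideal.span {X 0, X 1} : Ideal (MvPolynomial (Fin 2) k)) := by
  refine .of_forall_dvd_isUnit (Submodule.fg_span (Set.toFinite _)) fun d hd => ?_
  have h0 : d ∣ X 0 := hd _ (Ideal.subset_span (by simp))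
  have h1 : d ∣ X 1 := hd _ (Ideal.subset_span (by simp))
  by_contra hu
  have h01 : (X 0 : MvPolynomial (Fin 2) k) ∣ X 1 :=
    ((X_prime (R := k) (i := (0 : Fin 2))).irreducible.dvd_iff.1 h0 |>.resolve_left hu).dvd.trans h1
  simp [X_dvd_X] at h01

set_option synthInstance.maxHeartbeats 1000000 in
set_option maxHeartbeats 1000000 in
/-- for `R = k[x,y]` and `I = ⟨x,y⟩`: (a) `I` is a GV-ideal;
(b) `z = x ⊗ y - y ⊗ x ∈ I ⊗_R I` is nonzero and killed by `x` and by `y`;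
in particular `I ⊗_R I` is not GV-torsion-free, although `R` is a PvMD and `I` is
torsion-free. -/
theorem gvIdeal_tensor_not_gvTorsionFree (k : Type u) [Field k] :
    ∀ (hx : (MvPolynomial.X 0 : MvPolynomial (Fin 2) k) ∈
        (Ideal.span {MvPolynomial.X 0, MvPolynomial.X 1} :
          Ideal (MvPolynomial (Fin 2) k)))
      (hy : (MvPolynomial.X 1 : MvPolynomial (Fin 2) k) ∈
        (Ideal.span {MvPolynomial.X 0, MvPolynomial.X 1} :
          Ideal (MvPolynomial (Fin 2) k))),
      IsGVIdeal (Ideal.span {MvPolynomial.X 0, MvPolynomial.X 1} :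
          Ideal (MvPolynomial (Fin 2) k)) ∧
      ((⟨MvPolynomial.X 0, hx⟩ :
          (Ideal.span {MvPolynomial.X 0, MvPolynomial.X 1} :
            Ideal (MvPolynomial (Fin 2) k))) ⊗ₜ[MvPolynomial (Fin 2) k]
        (⟨MvPolynomial.X 1, hy⟩ :
          (Ideal.span {MvPolynomial.X 0, MvPolynomial.X 1} :
            Ideal (MvPolynomial (Fin 2) k))) -
        ⟨MvPolynomial.X 1, hy⟩ ⊗ₜ[MvPolynomial (Fin 2) k] ⟨MvPolynomial.X 0, hx⟩ ≠ 0) ∧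
      ((MvPolynomial.X 0 : MvPolynomial (Fin 2) k) •
        ((⟨MvPolynomial.X 0, hx⟩ :
          (Ideal.span {MvPolynomial.X 0, MvPolynomial.X 1} :
            Ideal (MvPolynomial (Fin 2) k))) ⊗ₜ[MvPolynomial (Fin 2) k]
          (⟨MvPolynomial.X 1, hy⟩ :
            (Ideal.span {MvPolynomial.X 0, MvPolynomial.X 1} :
              Ideal (MvPolynomial (Fin 2) k))) -
          ⟨MvPolynomial.X 1, hy⟩ ⊗ₜ[MvPolynomial (Fin 2) k] ⟨MvPolynomial.X 0, hx⟩) = 0) ∧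
      ((MvPolynomial.X 1 : MvPolynomial (Fin 2) k) •
        ((⟨MvPolynomial.X 0, hx⟩ :
          (Ideal.span {MvPolynomial.X 0, MvPolynomial.X 1} :
            Ideal (MvPolynomial (Fin 2) k))) ⊗ₜ[MvPolynomial (Fin 2) k]
          (⟨MvPolynomial.X 1, hy⟩ :
            (Ideal.span {MvPolynomial.X 0, MvPolynomial.X 1} :
              Ideal (MvPolynomial (Fin 2) k))) -
          ⟨MvPolynomial.X 1, hy⟩ ⊗ₜ[MvPolynomial (Fin 2) k] ⟨MvPolynomial.X 0, hx⟩) = 0) ∧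
      ¬(∀ w : (Ideal.span {MvPolynomial.X 0, MvPolynomial.X 1} :
            Ideal (MvPolynomial (Fin 2) k)) ⊗[MvPolynomial (Fin 2) k]
          (Ideal.span {MvPolynomial.X 0, MvPolynomial.X 1} :
            Ideal (MvPolynomial (Fin 2) k)),
          IsGVTorsionElem (MvPolynomial (Fin 2) k) w → w = 0) ∧
      IsPvMD (MvPolynomial (Fin 2) k) (FractionRing (MvPolynomial (Fin 2) k)) ∧
      (∀ (r : MvPolynomial (Fin 2) k)
        (m : (Ideal.span {MvPolynomial.X 0, MvPolynomial.X 1} :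
          Ideal (MvPolynomial (Fin 2) k))), r • m = 0 → r = 0 ∨ m = 0) := by
  intro hx hy
  have hGV := MvPolynomial.isGVIdeal_span_X_pair k
  have hne := Ideal.tmul_sub_tmul_ne_zero (MvPolynomial.span_X_pair_ne_top k)
    (MvPolynomial.pderiv 0) (MvPolynomial.pderiv 1) ⟨MvPolynomial.X 0, hx⟩
    ⟨MvPolynomial.X 1, hy⟩ (by simp) (by simp) (by simp)
  refine ⟨hGV, hne, Ideal.smul_tmul_sub_tmul_eq_zero _ _ hx,
    Ideal.smul_tmul_sub_tmul_eq_zero _ _ hy, fun h => hne (h _ ⟨_, hGV, fun j hj =>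
      Ideal.smul_tmul_sub_tmul_eq_zero _ _ hj⟩), .of_uniqueFactorizationMonoid _ _,
    fun r m hrm => smul_eq_zero.1 hrm⟩
end
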